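/- Let E be a finite-dimensional real normed vector space, G a finite group, and ρ : G →* (E ≃L[ℝ] E) a homomorphism into the continuous linear automorphisms of E. Suppose ω₁ and ω₂ are G-invariant smooth k-forms on E such that ω₁ = ω₂ + dη for some smooth (k−1)-form η on E. Then there exists a G-invariant smooth (k−1)-form η' on E with ω₁ = ω₂ + dη'. (In particular, two G-invariant forms that are cohomologous among all forms are already cohomologous through G-invariant forms.) -/

import Mathlib

/-!
STATEMENT 3: Let `E` be a finite-dimensional real normed vector space, `G` a finite group,
and `ρ : G →* (E ≃L[ℝ] E)`.  If `ω₁` and `ω₂` are `G`-invariant smooth `k`-forms on `E`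
with `ω₁ = ω₂ + dη` for some smooth `(k-1)`-form `η`, then there is a `G`-invariant smooth
`(k-1)`-form `η'` with `ω₁ = ω₂ + dη'`.
-/

noncomputable section

variable {E : Type*} [NormedAddCommGroup E] [NormedSpace ℝ E]

/-- The (unbundled) exterior derivative of a smooth differential `j`-form on a normed
space `E`:  `(dω)ₓ(v₀,…,v_j) = ∑ᵢ (-1)ⁱ (Dω(x) vᵢ)(v₀,…,v̂ᵢ,…,v_j)`. -/
def extDerivForm {j : ℕ} (ω : E → (E [⋀^Fin j]→L[ℝ] ℝ)) :
    E → (Fin (j + 1) → E) → ℝ :=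
  fun x v => ∑ i : Fin (j + 1), (-1 : ℝ) ^ (i : ℕ) *
    (fderiv ℝ (fun y => (ω y).toContinuousMultilinearMap) x (v i)) (v ∘ i.succAbove)

/-- Pullback of a (bundled) differential `j`-form along a continuous linear automorphism
`A` of `E`: `(A*ω)(x)(v₁,…,v_j) = ω(Ax)(Av₁,…,Av_j)`. -/
def pullbackForm (A : E ≃L[ℝ] E) {j : ℕ} (ω : E → (E [⋀^Fin j]→L[ℝ] ℝ)) :
    E → (E [⋀^Fin j]→L[ℝ] ℝ) :=
  fun x => (ω (A x)).compContinuousLinearMap (A : E →L[ℝ] E)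

/-- A differential form is smooth when, regarded as a map into continuous multilinear
maps, it is `C^∞`. -/
def SmoothForm {j : ℕ} (ω : E → (E [⋀^Fin j]→L[ℝ] ℝ)) : Prop :=
  ContDiff ℝ (⊤ : ℕ∞) fun x => (ω x).toContinuousMultilinearMap

variable {j : ℕ}

theorem SmoothForm.differentiable {ω : E → (E [⋀^Fin j]→L[ℝ] ℝ)} (hω : SmoothForm ω) :
    Differentiable ℝ fun x => (ω x).toContinuousMultilinearMap :=
  ContDiff.differentiable hω (by simp)

theorem SmoothForm.pullbackForm {ω : E → (E [⋀^Fin j]→L[ℝ] ℝ)} (hω : SmoothForm ω)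
    (A : E ≃L[ℝ] E) : SmoothForm (pullbackForm A ω) := by
  have h : ContDiff ℝ (⊤ : ℕ∞) fun x => (ω x).toContinuousMultilinearMap := hω
  exact (ContinuousLinearMap.contDiff (ContinuousMultilinearMap.compContinuousLinearMapL (F := ℝ)
    (fun _ : Fin j => (A : E →L[ℝ] E)))).comp (h.comp A.contDiff)

theorem extDerivForm_pullbackForm {ω : E → (E [⋀^Fin j]→L[ℝ] ℝ)} (hω : SmoothForm ω)
    (A : E ≃L[ℝ] E) (x : E) (v : Fin (j + 1) → E) :
    extDerivForm (pullbackForm A ω) x v = extDerivForm ω (A x) (A ∘ v) := by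
  have h := (ContinuousMultilinearMap.compContinuousLinearMapL (F := ℝ)
    (fun _ : Fin j => (A : E →L[ℝ] E))).hasFDerivAt.comp x
      ((hω.differentiable (A x)).hasFDerivAt.comp x A.hasFDerivAt)
  have h' : fderiv ℝ (fun y => (_root_.pullbackForm A ω y).toContinuousMultilinearMap) x = _ :=
    HasFDerivAt.fderiv h
  unfold extDerivForm
  rw [h']
  rfl

/-- The average of the pullbacks of a form along the elements of a finite group. -/
def averageForm {G : Type*} [Group G] [Fintype G] (ρ : G →* (E ≃L[ℝ] E))
    (ω : E → (E [⋀^Fin j]→L[ℝ] ℝ)) : E → (E [⋀^Fin j]→L[ℝ] ℝ) :=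
  fun x => (Fintype.card G : ℝ)⁻¹ • ∑ γ, pullbackForm (ρ γ) ω x

section Average

variable {G : Type*} [Group G] [Fintype G] (ρ : G →* (E ≃L[ℝ] E))

theorem toContinuousMultilinearMap_averageForm (ω : E → (E [⋀^Fin j]→L[ℝ] ℝ)) (x : E) :
    (averageForm ρ ω x).toContinuousMultilinearMap =
      (Fintype.card G : ℝ)⁻¹ • ∑ γ, (pullbackForm (ρ γ) ω x).toContinuousMultilinearMap := by
  ext v
  simp [averageForm, ContinuousAlternatingMap.sum_apply]

theorem SmoothForm.averageForm {ω : E → (E [⋀^Fin j]→L[ℝ] ℝ)} (hω : SmoothForm ω) :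
    SmoothForm (averageForm ρ ω) := by
  unfold SmoothForm
  simp only [toContinuousMultilinearMap_averageForm]
  exact (ContDiff.sum fun γ _ => hω.pullbackForm (ρ γ)).const_smul _

theorem pullbackForm_averageForm (γ : G) (ω : E → (E [⋀^Fin j]→L[ℝ] ℝ)) :
    pullbackForm (ρ γ) (averageForm ρ ω) = averageForm ρ ω := by
  ext x v
  have h : ∀ δ, pullbackForm (ρ δ) ω (ρ γ x) (ρ γ ∘ v) = pullbackForm (ρ (δ * γ)) ω x v :=
    fun δ => by rw [map_mul]; rfl
  change averageForm ρ ω (ρ γ x) (ρ γ ∘ v) = _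
  simp only [averageForm, ContinuousAlternatingMap.smul_apply,
    ContinuousAlternatingMap.sum_apply, h]
  congr 1
  exact Equiv.sum_comp (Equiv.mulRight γ) fun δ => pullbackForm (ρ δ) ω x v

theorem extDerivForm_averageForm {ω : E → (E [⋀^Fin j]→L[ℝ] ℝ)} (hω : SmoothForm ω)
    (x : E) (v : Fin (j + 1) → E) :
    extDerivForm (averageForm ρ ω) x v =
      (Fintype.card G : ℝ)⁻¹ * ∑ γ, extDerivForm ω (ρ γ x) (ρ γ ∘ v) := by
  have h : fderiv ℝ (fun y => (averageForm ρ ω y).toContinuousMultilinearMap) x =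
      (Fintype.card G : ℝ)⁻¹ •
        ∑ γ, fderiv ℝ (fun y => (pullbackForm (ρ γ) ω y).toContinuousMultilinearMap) x := by
    simp only [toContinuousMultilinearMap_averageForm]
    have hsum := HasFDerivAt.fun_sum (u := Finset.univ) fun γ _ =>
      ((hω.pullbackForm (ρ γ)).differentiable x).hasFDerivAt
    exact (hsum.const_smul (Fintype.card G : ℝ)⁻¹).fderiv
  simp only [← extDerivForm_pullbackForm hω]
  simp only [extDerivForm, h, smul_apply, sum_apply, smul_eq_mul, Finset.mul_sum]
  rw [Finset.sum_comm]
  exact Finset.sum_congr rfl fun _ _ => Finset.sum_congr rfl fun _ _ => mul_left_comm _ _ _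

end Average

theorem exists_invariant_primitive_of_cohomologous
    [FiniteDimensional ℝ E] {G : Type*} [Group G] [Fintype G]
    (ρ : G →* (E ≃L[ℝ] E)) (k : ℕ) (hk : 1 ≤ k)
    (ω₁ ω₂ : E → (E [⋀^Fin (k - 1 + 1)]→L[ℝ] ℝ))
    (hω₁ : SmoothForm ω₁) (hω₂ : SmoothForm ω₂)
    (hω₁inv : ∀ γ : G, pullbackForm (ρ γ) ω₁ = ω₁)
    (hω₂inv : ∀ γ : G, pullbackForm (ρ γ) ω₂ = ω₂)
    (η : E → (E [⋀^Fin (k - 1)]→L[ℝ] ℝ)) (hη : SmoothForm η)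
    (hd : ∀ (x : E) (v : Fin (k - 1 + 1) → E), ω₁ x v = ω₂ x v + extDerivForm η x v) :
    ∃ η' : E → (E [⋀^Fin (k - 1)]→L[ℝ] ℝ), SmoothForm η' ∧
      (∀ γ : G, pullbackForm (ρ γ) η' = η') ∧
      ∀ (x : E) (v : Fin (k - 1 + 1) → E), ω₁ x v = ω₂ x v + extDerivForm η' x v := by
  refine ⟨averageForm ρ η, hη.averageForm ρ, fun γ => pullbackForm_averageForm ρ γ η,
    fun x v => ?_⟩
  have h : ∀ γ, extDerivForm η (ρ γ x) (ρ γ ∘ v) = ω₁ x v - ω₂ x v := fun γ => by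
    have h₁ : ω₁ (ρ γ x) (ρ γ ∘ v) = ω₁ x v := DFunLike.congr_fun (congrFun (hω₁inv γ) x) v
    have h₂ : ω₂ (ρ γ x) (ρ γ ∘ v) = ω₂ x v := DFunLike.congr_fun (congrFun (hω₂inv γ) x) v
    rw [← h₁, ← h₂, hd, add_sub_cancel_left]
  rw [extDerivForm_averageForm ρ hη]
  simp_rw [h]
  rw [Finset.sum_const, Finset.card_univ, nsmul_eq_mul, inv_mul_cancel_left₀ (by simp),
    add_sub_cancel]

end
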